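/- Let D be a bounded domain in ℂⁿ, let A₁ ⊇ A₂ ⊇ A₃ ⊇ ⋯ be a decreasing sequence of compact subsets of ∂D and let A = ⋂_{j=1}^∞ A_j. Then for every z ∈ D, lim_{j→∞} ω(z, A_j, D) = ω(z, A, D). -/

import Mathlib

open Complex Metric MeasureTheory Filter Topology Set

noncomputable section

/-- The average of the truncation `max u (-m)` of an `EReal`-valued function `u` over the
circle of center `c` and radius `r`. -/
noncomputable def truncCircleAvg (u : ℂ → EReal) (c : ℂ) (r : ℝ) (m : ℕ) : ℝ :=
  (2 * Real.pi)⁻¹ *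
    ∫ θ in (0:ℝ)..(2 * Real.pi),
      (max (u (c + (r : ℂ) * Complex.exp (θ * Complex.I))) ((-(m : ℝ) : ℝ) : EReal)).toReal

/-- A `[-∞,∞]`-valued function is subharmonic on `U ⊆ ℂ` if it is upper semicontinuous
on `U` and satisfies the sub-mean value inequality on every closed disc contained in `U`
(expressed via averages of truncations from below). -/
def SubharmonicOn (u : ℂ → EReal) (U : Set ℂ) : Prop :=
  UpperSemicontinuousOn u U ∧
    ∀ c r, 0 < r → Metric.closedBall c r ⊆ U →
      ∀ m : ℕ, u c ≤ ((truncCircleAvg u c r m : ℝ) : EReal)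

variable {E : Type*} [NormedAddCommGroup E] [NormedSpace ℂ E]

/-- Plurisubharmonic on `D`: upper semicontinuous on `D`, with values in `[-∞, ∞)`,
whose restriction to every complex line is subharmonic.  (The constant `-∞` is allowed
here; the paper's class `PSH(D)` additionally requires `u ≢ -∞`, see `MemPSH`.) -/
def PshOn (u : E → EReal) (D : Set E) : Prop :=
  UpperSemicontinuousOn u D ∧ (∀ z ∈ D, u z ≠ ⊤) ∧
    ∀ a b : E, SubharmonicOn (fun ζ : ℂ => u (a + ζ • b)) {ζ : ℂ | a + ζ • b ∈ D}

/-- Membership in the paper's class `PSH(D)`: plurisubharmonic and not identically `-∞`. -/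
def MemPSH (u : E → EReal) (D : Set E) : Prop :=
  PshOn u D ∧ ∃ z ∈ D, u z ≠ ⊥

/-- The upper semicontinuous regularization `u*` of `u` on `cl(D)`:
`u*(x) = limsup_{z → x, z ∈ D} u(z)`. -/
noncomputable def uscReg (u : E → EReal) (D : Set E) (x : E) : EReal :=
  Filter.limsup u (nhdsWithin x D)

/-- The boundary relative extremal function
`ω(z, A, D) = sup { u(z) : u ∈ PSH(D), u ≤ 0 on D, u* ≤ -1 on A }`. -/
noncomputable def bndExt (z : E) (A D : Set E) : EReal :=
  sSup {w : EReal | ∃ u : E → EReal, MemPSH u D ∧ (∀ y ∈ D, u y ≤ 0) ∧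
    (∀ x ∈ A, uscReg u D x ≤ -1) ∧ w = u z}

/-- The upper semicontinuous regularization `ω*(·, A, D)` on `cl(D)`. -/
noncomputable def bndExtStar (x : E) (A D : Set E) : EReal :=
  Filter.limsup (fun z => bndExt z A D) (nhdsWithin x D)

/-- A bounded domain: a nonempty connected bounded open set. -/
def IsBddDomain (D : Set E) : Prop :=
  IsOpen D ∧ IsConnected D ∧ Bornology.IsBounded D

/-- `A ⊆ ∂D` is b-pluripolar if there is `u ∈ PSH(D)`, `u ≤ 0`, `u ≢ -∞`,
with `u* = -∞` on `A`. -/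
def BPluripolar (A D : Set E) : Prop :=
  ∃ u : E → EReal, PshOn u D ∧ (∀ z ∈ D, u z ≤ 0) ∧ (∃ z ∈ D, u z ≠ ⊥) ∧
    ∀ x ∈ A, uscReg u D x = ⊥

/-- The b-pluripolar hull `Â` of `A ⊆ ∂D`: all points `z ∈ cl(D)` such that `u*(z) = -∞`
for every negative `u ∈ PSH(D)`, `u ≢ -∞`, with `u* = -∞` on `A`. -/
def bHull (A D : Set E) : Set E :=
  {z ∈ closure D | ∀ u : E → EReal, PshOn u D → (∀ y ∈ D, u y < 0) →
    (∃ y ∈ D, u y ≠ ⊥) → (∀ x ∈ A, uscReg u D x = ⊥) → uscReg u D z = ⊥}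

/-- Weak regularity: for every relatively open `U ⊆ ∂D` one has `ω*(·, U, D) ≤ -1` on `U`. -/
def WeaklyRegular (D : Set E) : Prop :=
  ∀ U W : Set E, IsOpen W → U = W ∩ frontier D → ∀ x ∈ U, bndExtStar x U D ≤ -1

/-- B-regularity (Sibony): every continuous `f : ∂D → ℝ` extends to a function
plurisubharmonic on `D` and continuous on `cl(D)` with boundary values `f`. -/
def BRegular (D : Set E) : Prop :=
  ∀ f : E → ℝ, ContinuousOn f (frontier D) →
    ∃ F : E → ℝ, ContinuousOn F (closure D) ∧
      PshOn (fun z => ((F z : ℝ) : EReal)) D ∧ ∀ x ∈ frontier D, F x = f x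

/-- The extremal function `ω₁(z, K, D)`, defined with continuous-up-to-the-boundary
plurisubharmonic competitors. -/
noncomputable def bndExtCont (z : E) (K D : Set E) : EReal :=
  sSup {w : EReal | ∃ F : E → ℝ, ContinuousOn F (closure D) ∧
    PshOn (fun y => ((F y : ℝ) : EReal)) D ∧ (∀ y ∈ closure D, F y ≤ 0) ∧
    (∀ x ∈ K, F x ≤ -1) ∧ w = ((F z : ℝ) : EReal)}

end

lemma ereal_continuous_add_coe (c : ℝ) : Continuous (fun x : EReal => x + (c : EReal)) := by
  rw [continuous_iff_continuousAt]
  intro x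
  have h := EReal.continuousAt_add (p := (x, (c : EReal))) (by simp) (by simp)
  exact h.comp (f := fun x : EReal => (x, (c : EReal))) (by fun_prop)

lemma ereal_monotone_add_coe (c : ℝ) : Monotone (fun x : EReal => x + (c : EReal)) :=
  fun _ _ h => add_le_add_left h _

/-- Truncations of a nonpositive u.s.c. function are integrable on circles. -/
lemma trunc_integrable (u : ℂ → EReal) (U : Set ℂ) (hu : UpperSemicontinuousOn u U)
    (hneg : ∀ ζ ∈ U, u ζ ≤ 0) (c : ℂ) (r : ℝ) (hr : 0 < r)
    (hcU : Metric.closedBall c r ⊆ U) (m : ℕ) :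
    IntervalIntegrable (fun θ : ℝ =>
      (max (u (c + (r : ℂ) * Complex.exp (θ * Complex.I))) ((-(m : ℝ) : ℝ) : EReal)).toReal)
      volume 0 (2 * Real.pi) := by
  have hmem : ∀ θ : ℝ, c + (r : ℂ) * Complex.exp (θ * Complex.I) ∈ U := by
    intro θ
    apply hcU
    simp [Complex.norm_exp_ofReal_mul_I, abs_of_pos hr]
  have husc : UpperSemicontinuous
      (fun θ : ℝ => u (c + (r : ℂ) * Complex.exp (θ * Complex.I))) := by
    intro θ y hy
    have h1 := hu _ (hmem θ) y hy
    have hc : Continuous (fun θ : ℝ => c + (r : ℂ) * Complex.exp (θ * Complex.I)) := by fun_prop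
    have ht : Tendsto (fun θ : ℝ => c + (r : ℂ) * Complex.exp (θ * Complex.I)) (𝓝 θ)
        (𝓝[U] (c + (r : ℂ) * Complex.exp (θ * Complex.I))) :=
      tendsto_nhdsWithin_iff.2 ⟨hc.continuousAt, Eventually.of_forall hmem⟩
    exact ht.eventually h1
  have hmeas : Measurable (fun θ : ℝ =>
      (max (u (c + (r : ℂ) * Complex.exp (θ * Complex.I))) ((-(m : ℝ) : ℝ) : EReal)).toReal) :=
    (husc.measurable.max measurable_const).ereal_toReal
  refine (intervalIntegrable_const (c := (m : ℝ))).mono_fun' hmeas.aestronglyMeasurable ?_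
  refine Eventually.of_forall fun θ => ?_
  have h0 := hneg _ (hmem θ)
  simp only
  generalize u (c + (r : ℂ) * Complex.exp (θ * Complex.I)) = a at h0
  have hle : max a ((-(m : ℝ) : ℝ) : EReal) ≤ 0 := by
    refine max_le h0 ?_
    exact_mod_cast (by simp : -(m : ℝ) ≤ 0)
  have hge : ((-(m : ℝ) : ℝ) : EReal) ≤ max a ((-(m : ℝ) : ℝ) : EReal) := le_max_right _ _
  generalize max a ((-(m : ℝ) : ℝ) : EReal) = b at hle hge
  induction b with
  | bot => simp
  | top => simp
  | coe b =>
    have h1 : b ≤ 0 := by exact_mod_cast hle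
    have h2 : -(m : ℝ) ≤ b := by exact_mod_cast hge
    simp only [EReal.toReal_coe, Real.norm_eq_abs]
    rw [abs_le]; constructor <;> linarith

lemma trunc_shift (a : EReal) (ha : a ≤ 0) (ε : ℝ) (hε : 0 < ε) (m : ℕ) :
    (max a ((-(m : ℝ) : ℝ) : EReal)).toReal - ε ≤
      (max (a + ((-ε : ℝ) : EReal)) ((-(m : ℝ) : ℝ) : EReal)).toReal := by
  induction a with
  | bot => simp [hε.le]
  | top => simp at ha
  | coe a =>
    have hmax : ∀ x y : ℝ, max (x : EReal) (y : EReal) = ((max x y : ℝ) : EReal) := fun x y =>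
      (EReal.coe_strictMono.monotone.map_max).symm
    rw [← EReal.coe_add, hmax, hmax, EReal.toReal_coe, EReal.toReal_coe]
    rcases le_total a (-(m : ℝ)) with h | h
    · rw [max_eq_right h]
      linarith [le_max_right (a + -ε) (-(m : ℝ))]
    · rw [max_eq_left h]
      linarith [le_max_left (a + -ε) (-(m : ℝ))]

lemma subharmonicOn_shift (u : ℂ → EReal) (U : Set ℂ) (hu : SubharmonicOn u U)
    (hneg : ∀ ζ ∈ U, u ζ ≤ 0) (ε : ℝ) (hε : 0 < ε) :
    SubharmonicOn (fun ζ => u ζ + ((-ε : ℝ) : EReal)) U := by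
  have hv : UpperSemicontinuousOn (fun ζ => u ζ + ((-ε : ℝ) : EReal)) U :=
    (ereal_continuous_add_coe (-ε)).comp_upperSemicontinuousOn hu.1 (ereal_monotone_add_coe (-ε))
  refine ⟨hv, fun c r hr hcU m => ?_⟩
  have hvneg : ∀ ζ ∈ U, u ζ + ((-ε : ℝ) : EReal) ≤ 0 := fun ζ hζ => by
    have h2 : ((-ε : ℝ) : EReal) ≤ 0 := by exact_mod_cast (by linarith : -ε ≤ 0)
    simpa using add_le_add (hneg ζ hζ) h2
  have h1 := hu.2 c r hr hcU m
  have hi := trunc_integrable u U hu.1 hneg c r hr hcU m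
  have hi' := trunc_integrable _ U hv hvneg c r hr hcU m
  have key : truncCircleAvg u c r m - ε ≤
      truncCircleAvg (fun ζ => u ζ + ((-ε : ℝ) : EReal)) c r m := by
    have hpi := Real.pi_pos
    have h3 := intervalIntegral.integral_mono_on (by positivity : (0:ℝ) ≤ 2 * Real.pi)
      (hi.sub (intervalIntegrable_const (c := ε))) hi' (fun θ _ => trunc_shift _ (hneg _ (hcU (by
        simp [Complex.norm_exp_ofReal_mul_I, abs_of_pos hr]))) ε hε m)
    rw [intervalIntegral.integral_sub hi intervalIntegrable_const,
      intervalIntegral.integral_const] at h3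
    unfold truncCircleAvg
    have h4 := mul_le_mul_of_nonneg_left h3 (by positivity : 0 ≤ (2 * Real.pi)⁻¹)
    rw [mul_sub] at h4
    have h5 : (2 * Real.pi)⁻¹ * ((2 * Real.pi - 0) • ε) = ε := by
      simp only [sub_zero, smul_eq_mul]; field_simp
    rw [h5] at h4
    exact h4
  calc u c + ((-ε : ℝ) : EReal) ≤ ((truncCircleAvg u c r m : ℝ) : EReal) + ((-ε : ℝ) : EReal) :=
        add_le_add_left h1 _
    _ = ((truncCircleAvg u c r m - ε : ℝ) : EReal) := by rw [← EReal.coe_add, sub_eq_add_neg]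
    _ ≤ _ := by exact_mod_cast key

lemma memPSH_shift {E : Type*} [NormedAddCommGroup E] [NormedSpace ℂ E] (u : E → EReal)
    (D : Set E) (hu : MemPSH u D) (hneg : ∀ y ∈ D, u y ≤ 0) (ε : ℝ) (hε : 0 < ε) :
    MemPSH (fun y => u y + ((-ε : ℝ) : EReal)) D := by
  obtain ⟨⟨h1, h2, h3⟩, z, hz, hzb⟩ := hu
  refine ⟨⟨?_, fun y hy => ?_, fun a b => ?_⟩, z, hz, ?_⟩
  · exact (ereal_continuous_add_coe (-ε)).comp_upperSemicontinuousOn h1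
      (ereal_monotone_add_coe (-ε))
  · exact EReal.add_ne_top (h2 y hy) (EReal.coe_ne_top _)
  · exact subharmonicOn_shift (fun ζ => u (a + ζ • b)) _ (h3 a b) (fun ζ hζ => hneg _ hζ) ε hε
  · simp only [ne_eq, EReal.add_eq_bot_iff, not_or]
    exact ⟨hzb, EReal.coe_ne_bot _⟩

lemma bndExt_anti {E : Type*} [NormedAddCommGroup E] [NormedSpace ℂ E] (z : E) (D : Set E)
    {A B : Set E} (h : A ⊆ B) : bndExt z B D ≤ bndExt z A D := by
  apply sSup_le_sSup
  rintro w ⟨u, h1, h2, h3, h4⟩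
  exact ⟨u, h1, h2, fun x hx => h3 x (h hx), h4⟩

/-- For a decreasing sequence of compact subsets `A j` of `∂D` with
intersection `A`, one has `ω(z, A j, D) → ω(z, A, D)` for every `z ∈ D`. -/
theorem bndExt_tendsto_of_antitone_compact {n : ℕ}
    (D : Set (EuclideanSpace ℂ (Fin n))) (hD : IsBddDomain D)
    (A : ℕ → Set (EuclideanSpace ℂ (Fin n)))
    (hcpt : ∀ j, IsCompact (A j)) (hbd : ∀ j, A j ⊆ frontier D) (hmono : Antitone A) :
    ∀ z ∈ D,
      Tendsto (fun j => bndExt z (A j) D) atTop (𝓝 (bndExt z (⋂ j, A j) D)) := by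
  intro z hz
  rw [tendsto_order]
  refine ⟨fun a ha => ?_, fun a ha => Eventually.of_forall fun j =>
    (bndExt_anti z D (iInter_subset A j)).trans_lt ha⟩
  obtain ⟨w, ⟨u, hu, hneg, hA, rfl⟩, haw⟩ := lt_sSup_iff.1 ha
  obtain ⟨b, hab, hbu⟩ := EReal.lt_iff_exists_real_btwn.1 haw
  obtain ⟨r, hr⟩ : ∃ r : ℝ, u z = (r : EReal) :=
    ⟨(u z).toReal, (EReal.coe_toReal (hu.1.2.1 z hz) (ne_bot_of_gt haw)).symm⟩
  rw [hr] at hbu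
  have hbr : b < r := by exact_mod_cast hbu
  have hε : 0 < r - b := by linarith
  have hlt : (-1 : EReal) < ((-1 + (r - b) : ℝ) : EReal) := by
    have : ((-1 : ℝ) : EReal) < ((-1 + (r - b) : ℝ) : EReal) := by
      exact_mod_cast (by linarith : (-1 : ℝ) < -1 + (r - b))
    simpa using this
  obtain ⟨j, hj⟩ := exists_subset_nhds_of_isCompact (V := A)
    (U := {x | ∀ᶠ y in 𝓝[D] x, u y < ((-1 + (r - b) : ℝ) : EReal)})
    (hmono.directed_ge) hcpt (fun x hx => by
      have h1 : uscReg u D x < ((-1 + (r - b) : ℝ) : EReal) := (hA x hx).trans_lt hlt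
      exact eventually_nhds_nhdsWithin.2 (eventually_lt_of_limsup_lt h1))
  filter_upwards [eventually_ge_atTop j] with k hk
  refine hab.trans_le (le_sSup ?_)
  refine ⟨fun y => u y + ((-(r - b) : ℝ) : EReal), memPSH_shift u D hu hneg _ hε,
    fun y hy => ?_, fun x hx => ?_, ?_⟩
  · have h2 : ((-(r - b) : ℝ) : EReal) ≤ 0 := by exact_mod_cast (by linarith : -(r - b) ≤ 0)
    simpa using add_le_add (hneg y hy) h2
  · refine limsup_le_of_le (h := ?_)
    filter_upwards [hj (hmono hk hx)] with y hy
    refine (add_le_add_left hy.le _).trans ?_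
    rw [← EReal.coe_add, add_neg_cancel_right]
    simp
  · simp only [hr]
    rw [← EReal.coe_add]
    congr 1
    ring
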